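/- The operators 𝐷̂_i = D_i + β(i−1) − β Σ_{j<i} (1 − K_{ij}), i = 1,…,N, pairwise commute: [𝐷̂_i, 𝐷̂_j] = 0 for all i, j. -/

import Mathlib

open MvPolynomial Finset

section CSDefs

variable {F : Type*} [Field F] [CharZero F]

/-- Exact division in a polynomial ring: `divExact d f = f / d` when `d ∣ f`, junk otherwise. -/
noncomputable def divExact {σ : Type*} (d f : MvPolynomial σ F) : MvPolynomial σ F := by
  classical exact if h : ∃ c, f = d * c then h.choose else 0

/-- The exchange operator `K_{ij}` permuting the variables `z_i` and `z_j`. -/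
noncomputable def Kswap {N : ℕ} (i j : Fin N) (f : MvPolynomial (Fin N) F) :
    MvPolynomial (Fin N) F :=
  rename (Equiv.swap i j) f

/-- The Dunkl operator `∇_i = ∂_i + β ∑_{j ≠ i} (z_i - z_j)⁻¹ (1 - K_{ij})`. -/
noncomputable def nabla {N : ℕ} (β : F) (i : Fin N) (f : MvPolynomial (Fin N) F) :
    MvPolynomial (Fin N) F :=
  pderiv i f + β • ∑ j ∈ Finset.univ.erase i, divExact (X i - X j) (f - Kswap i j f)

/-- `D_i = z_i ∇_i`. -/
noncomputable def Dop {N : ℕ} (β : F) (i : Fin N) (f : MvPolynomial (Fin N) F) :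
    MvPolynomial (Fin N) F :=
  X i * nabla β i f

/-- `(D_{j₁} + kβ)(D_{j₂} + (k+1)β) ⋯` applied along a list of indices. -/
noncomputable def Dlist {N : ℕ} (β : F) :
    ℕ → List (Fin N) → MvPolynomial (Fin N) F → MvPolynomial (Fin N) F
  | _, [], f => f
  | k, j :: rest, f => Dop β j (Dlist β (k + 1) rest f) + ((k : F) * β) • Dlist β (k + 1) rest f

/-- `D_{k,J} = (D_{j₁} + kβ)(D_{j₂} + (k+1)β) ⋯ (D_{j_ℓ} + (k+ℓ-1)β)` for
`J = {j₁ < j₂ < … < j_ℓ}`. -/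
noncomputable def DJ {N : ℕ} (β : F) (k : ℕ) (J : Finset (Fin N))
    (f : MvPolynomial (Fin N) F) : MvPolynomial (Fin N) F :=
  Dlist β k (J.sort (· ≤ ·)) f

/-- `z_J = ∏_{i ∈ J} z_i`. -/
noncomputable def zJ {N : ℕ} (J : Finset (Fin N)) : MvPolynomial (Fin N) F := ∏ i ∈ J, X i

/-- The creation operator `B⁺_{i,J} = ∑_{J' ⊆ J, |J'| = i} z_{J'} D_{1,J'}`. -/
noncomputable def Bplus {N : ℕ} (β : F) (i : ℕ) (J : Finset (Fin N))
    (f : MvPolynomial (Fin N) F) : MvPolynomial (Fin N) F :=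
  ∑ J' ∈ J.powersetCard i, zJ J' * DJ β 1 J' f

/-- `A_{ij} = ((z_i+z_j)/(z_i-z_j))(z_i ∂_i - z_j ∂_j)`. -/
noncomputable def Aop {N : ℕ} (i j : Fin N) (f : MvPolynomial (Fin N) F) :
    MvPolynomial (Fin N) F :=
  divExact (X i - X j) ((X i + X j) * (X i * pderiv i f - X j * pderiv j f))

/-- `H^{(S)} = ∑_{i ∈ S} (z_i ∂_i)² + β ∑_{i<j, i,j ∈ S} A_{ij}`. -/
noncomputable def Hop {N : ℕ} (β : F) (S : Finset (Fin N)) (f : MvPolynomial (Fin N) F) :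
    MvPolynomial (Fin N) F :=
  ∑ i ∈ S, X i * pderiv i (X i * pderiv i f)
    + β • ∑ i ∈ S, ∑ j ∈ S.filter (fun j => i < j), Aop i j f

/-- A polynomial is symmetric in the variables indexed by `S`. -/
def SymmOn {N : ℕ} (S : Finset (Fin N)) (f : MvPolynomial (Fin N) F) : Prop :=
  ∀ i ∈ S, ∀ j ∈ S, rename (Equiv.swap i j) f = f

/-- `phiCS β N lam i = (B⁺_i)^{λ_i - λ_{i+1}} ⋯ (B⁺_1)^{λ_1 - λ_2} · 1`,
where `lam` is 0-indexed: `lam (j-1) = λ_j`. -/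
noncomputable def phiCS (β : F) (N : ℕ) (lam : ℕ → ℕ) : ℕ → MvPolynomial (Fin N) F
  | 0 => 1
  | i + 1 => (fun f => Bplus β (i + 1) Finset.univ f)^[lam i - lam (i + 1)] (phiCS β N lam i)

/-- The monomial symmetric polynomial attached to an exponent vector. -/
noncomputable def msym (N : ℕ) (lam : Fin N → ℕ) : MvPolynomial (Fin N) F := by
  classical
  exact ∑ v ∈ (Finset.univ : Finset (Equiv.Perm (Fin N))).image
      (fun σ => fun i => lam (σ i)), ∏ i, X i ^ v i

/-- `𝐷̂_i = D_i + β(i-1) - β ∑_{j<i} (1 - K_{ij})` (0-indexed: `i-1` becomes `i`). -/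
noncomputable def Dhat {N : ℕ} (β : F) (i : Fin N) (f : MvPolynomial (Fin N) F) :
    MvPolynomial (Fin N) F :=
  Dop β i f + (β * ((i : ℕ) : F)) • f
    - β • ∑ j ∈ Finset.univ.filter (fun j => j < i), (f - Kswap i j f)

end CSDefs

section Dunkl

variable {F : Type*} [Field F] {N : ℕ}

theorem X_sub_X_dvd_sub_Kswap (i j : Fin N) (f : MvPolynomial (Fin N) F) :
    (X i - X j) ∣ f - Kswap i j f := by
  induction f using MvPolynomial.induction_on with
  | C a => simp [Kswap]
  | add p q hp hq =>
    have h : p + q - Kswap i j (p + q) = (p - Kswap i j p) + (q - Kswap i j q) := by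
      simp only [Kswap, map_add]; ring
    rw [h]
    exact dvd_add hp hq
  | mul_X p k hp =>
    have h : p * X k - Kswap i j (p * X k)
        = (p - Kswap i j p) * X (Equiv.swap i j k) + p * (X k - X (Equiv.swap i j k)) := by
      simp only [Kswap, map_mul, rename_X]; ring
    rw [h]
    refine dvd_add (dvd_mul_of_dvd_left hp _) (dvd_mul_of_dvd_right ?_ _)
    rcases eq_or_ne k i with rfl | hi
    · simp
    rcases eq_or_ne k j with rfl | hj
    · rw [Equiv.swap_apply_right, ← neg_sub, neg_dvd]
    · simp [Equiv.swap_apply_of_ne_of_ne hi hj]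

theorem mul_divExact {σ : Type*} {d f : MvPolynomial σ F} (h : d ∣ f) :
    d * divExact d f = f := by
  have h' : ∃ c, f = d * c := h
  rw [divExact, dif_pos h']
  exact h'.choose_spec.symm

theorem X_sub_X_ne_zero {i j : Fin N} (h : j ≠ i) :
    (X i - X j : MvPolynomial (Fin N) F) ≠ 0 :=
  sub_ne_zero.2 fun e => h (X_injective e).symm

theorem mul_divExact_Kswap (i j : Fin N) (f : MvPolynomial (Fin N) F) :
    (X i - X j) * divExact (X i - X j) (f - Kswap i j f) = f - Kswap i j f :=
  mul_divExact (X_sub_X_dvd_sub_Kswap i j f)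

theorem divExact_Kswap_eq {i j : Fin N} (h : j ≠ i) {f g : MvPolynomial (Fin N) F}
    (hg : (X i - X j) * g = f - Kswap i j f) :
    divExact (X i - X j) (f - Kswap i j f) = g :=
  mul_left_cancel₀ (X_sub_X_ne_zero h) ((mul_divExact_Kswap i j f).trans hg.symm)

theorem Kswap_comm (i j : Fin N) (f : MvPolynomial (Fin N) F) :
    Kswap i j f = Kswap j i f := by
  rw [Kswap, Kswap, Equiv.swap_comm]

theorem rename_Kswap (σ : Equiv.Perm (Fin N)) (i j : Fin N) (f : MvPolynomial (Fin N) F) :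
    rename σ (Kswap i j f) = Kswap (σ i) (σ j) (rename σ f) := by
  simp only [Kswap, rename_rename]
  congr 2
  funext k
  simp [Equiv.swap_apply_def, apply_ite σ]

theorem nabla_add (β : F) (i : Fin N) (f g : MvPolynomial (Fin N) F) :
    nabla β i (f + g) = nabla β i f + nabla β i g := by
  have h : ∀ j ∈ univ.erase i, divExact (X i - X j) (f + g - Kswap i j (f + g))
      = divExact (X i - X j) (f - Kswap i j f) + divExact (X i - X j) (g - Kswap i j g) := by
    intro j hj
    refine divExact_Kswap_eq (ne_of_mem_erase hj) ?_
    rw [mul_add, mul_divExact_Kswap, mul_divExact_Kswap]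
    simp only [Kswap, map_add]
    ring
  rw [nabla, nabla, nabla, sum_congr rfl h, sum_add_distrib, map_add, smul_add]
  abel

theorem nabla_smul (β : F) (i : Fin N) (c : F) (f : MvPolynomial (Fin N) F) :
    nabla β i (c • f) = c • nabla β i f := by
  have h : ∀ j ∈ univ.erase i, divExact (X i - X j) (c • f - Kswap i j (c • f))
      = c • divExact (X i - X j) (f - Kswap i j f) := by
    intro j hj
    refine divExact_Kswap_eq (ne_of_mem_erase hj) ?_
    rw [mul_smul_comm, mul_divExact_Kswap]
    simp only [Kswap, map_smul, smul_sub]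
  rw [nabla, nabla, sum_congr rfl h, ← smul_sum, Derivation.map_smul, smul_add, smul_comm β c]

/-- The Dunkl operator `nabla β i` as a linear map. -/
noncomputable def nablaLinear (β : F) (i : Fin N) :
    MvPolynomial (Fin N) F →ₗ[F] MvPolynomial (Fin N) F where
  toFun := nabla β i
  map_add' := nabla_add β i
  map_smul' := nabla_smul β i

theorem nabla_sub (β : F) (i : Fin N) (f g : MvPolynomial (Fin N) F) :
    nabla β i (f - g) = nabla β i f - nabla β i g :=
  map_sub (nablaLinear β i) f g

theorem nabla_sum {ι : Type*} (β : F) (i : Fin N) (s : Finset ι)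
    (f : ι → MvPolynomial (Fin N) F) :
    nabla β i (∑ k ∈ s, f k) = ∑ k ∈ s, nabla β i (f k) :=
  map_sum (nablaLinear β i) f s

theorem nabla_C (β : F) (i : Fin N) (a : F) :
    nabla β i (C a : MvPolynomial (Fin N) F) = 0 := by
  have h : ∀ j ∈ univ.erase i, divExact (X i - X j) (C a - Kswap i j (C a)) = 0 := by
    intro j hj
    refine divExact_Kswap_eq (ne_of_mem_erase hj) ?_
    simp [Kswap]
  rw [nabla, sum_congr rfl h]
  simp

theorem rename_nabla (β : F) (σ : Equiv.Perm (Fin N)) (i : Fin N)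
    (f : MvPolynomial (Fin N) F) :
    rename σ (nabla β i f) = nabla β (σ i) (rename σ f) := by
  rw [nabla, nabla, map_add, map_smul, map_sum, pderiv_rename σ.injective]
  congr 2
  refine sum_bij (fun j _ => σ j) (by simp) (by simp) ?_ ?_
  · intro k hk
    exact ⟨σ.symm k, by simpa [Equiv.symm_apply_eq] using hk, by simp⟩
  · intro j hj
    refine (divExact_Kswap_eq (σ.injective.ne (ne_of_mem_erase hj)) ?_).symm
    have h := congrArg (rename σ) (mul_divExact_Kswap i j f)
    rw [map_mul, map_sub, map_sub, rename_X, rename_X, rename_Kswap] at h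
    exact h

theorem Kswap_nabla (β : F) (i j k : Fin N) (f : MvPolynomial (Fin N) F) :
    Kswap i j (nabla β k f) = nabla β (Equiv.swap i j k) (Kswap i j f) :=
  rename_nabla β _ k f

theorem Kswap_nabla_of_ne (β : F) {i j k : Fin N} (hi : k ≠ i) (hj : k ≠ j)
    (f : MvPolynomial (Fin N) F) :
    Kswap i j (nabla β k f) = nabla β k (Kswap i j f) := by
  rw [Kswap_nabla, Equiv.swap_apply_of_ne_of_ne hi hj]

theorem nabla_X_mul_self (β : F) (i : Fin N) (f : MvPolynomial (Fin N) F) :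
    nabla β i (X i * f) = X i * nabla β i f + f + β • ∑ j ∈ univ.erase i, Kswap i j f := by
  have h : ∀ j ∈ univ.erase i, divExact (X i - X j) (X i * f - Kswap i j (X i * f))
      = X i * divExact (X i - X j) (f - Kswap i j f) + Kswap i j f := by
    intro j hj
    refine divExact_Kswap_eq (ne_of_mem_erase hj) ?_
    rw [mul_add, mul_left_comm, mul_divExact_Kswap]
    simp only [Kswap, map_mul, rename_X, Equiv.swap_apply_left]
    ring
  rw [nabla, nabla, sum_congr rfl h, sum_add_distrib, ← mul_sum, Derivation.leibniz,
    pderiv_X_self, smul_add, mul_add, mul_smul_comm]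
  simp only [smul_eq_mul]
  ring

theorem nabla_X_mul_of_ne (β : F) {i k : Fin N} (hk : k ≠ i) (f : MvPolynomial (Fin N) F) :
    nabla β i (X k * f) = X k * nabla β i f - β • Kswap i k f := by
  have h : ∀ j ∈ univ.erase i, divExact (X i - X j) (X k * f - Kswap i j (X k * f))
      = X k * divExact (X i - X j) (f - Kswap i j f) - if j = k then Kswap i k f else 0 := by
    intro j hj
    refine divExact_Kswap_eq (ne_of_mem_erase hj) ?_
    rw [mul_sub, mul_left_comm, mul_divExact_Kswap]
    rcases eq_or_ne j k with rfl | hjk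
    · simp only [Kswap, map_mul, rename_X, Equiv.swap_apply_right, if_true]
      ring
    · simp only [Kswap, map_mul, rename_X, Equiv.swap_apply_of_ne_of_ne hk hjk.symm, if_neg hjk]
      ring
  rw [nabla, nabla, sum_congr rfl h, sum_sub_distrib, ← mul_sum, Derivation.leibniz,
    pderiv_X_of_ne hk, sum_ite_eq', if_pos (mem_erase.2 ⟨hk, mem_univ k⟩), smul_sub, mul_add,
    mul_smul_comm]
  simp only [smul_eq_mul]
  ring

theorem nabla_nabla_X_mul_sub (β : F) {i j : Fin N} (hij : i ≠ j)
    (f : MvPolynomial (Fin N) F) :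
    nabla β i (nabla β j (X i * f)) - nabla β j (nabla β i (X i * f))
      = X i * (nabla β i (nabla β j f) - nabla β j (nabla β i f)) := by
  have hj : j ∈ univ.erase i := mem_erase.2 ⟨hij.symm, mem_univ j⟩
  have h : ∑ l ∈ (univ.erase i).erase j, nabla β j (Kswap i l f)
      = ∑ l ∈ (univ.erase i).erase j, Kswap i l (nabla β j f) :=
    sum_congr rfl fun l hl => (Kswap_nabla_of_ne β hij.symm (ne_of_mem_erase hl).symm f).symm
  rw [nabla_X_mul_of_ne β hij, nabla_sub, nabla_smul, nabla_X_mul_self, nabla_X_mul_self,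
    nabla_add, nabla_add, nabla_smul, nabla_sum, nabla_X_mul_of_ne β hij, Kswap_comm j i,
    Kswap_comm j i, ← add_sum_erase _ _ hj, ← add_sum_erase _ _ hj, h, Kswap_nabla, Kswap_nabla,
    Equiv.swap_apply_left, Equiv.swap_apply_right]
  simp only [smul_add, mul_sub]
  ring

/-- The Dunkl operators commute. -/
theorem nabla_comm (β : F) (i j : Fin N) (f : MvPolynomial (Fin N) F) :
    nabla β i (nabla β j f) = nabla β j (nabla β i f) := by
  rcases eq_or_ne i j with rfl | hij
  · rfl
  induction f using MvPolynomial.induction_on with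
  | C a => simp only [nabla_C, ← C_0 (R := F) (σ := Fin N)]
  | add p q hp hq => simp only [nabla_add, hp, hq]
  | mul_X p k hp =>
    rw [mul_comm]
    rcases eq_or_ne k i with rfl | hi
    · rw [← sub_eq_zero, nabla_nabla_X_mul_sub β hij, hp, sub_self, mul_zero]
    rcases eq_or_ne k j with rfl | hj
    · rw [← sub_eq_zero, ← neg_sub, nabla_nabla_X_mul_sub β hij.symm, hp, sub_self, mul_zero,
        neg_zero]
    · rw [nabla_X_mul_of_ne β hj, nabla_X_mul_of_ne β hi, nabla_sub, nabla_sub, nabla_smul,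
        nabla_smul, nabla_X_mul_of_ne β hi, nabla_X_mul_of_ne β hj,
        Kswap_nabla_of_ne β hij.symm hj.symm, Kswap_nabla_of_ne β hij hi.symm, hp]
      ring

theorem Kswap_Dop (β : F) (i j k : Fin N) (f : MvPolynomial (Fin N) F) :
    Kswap i j (Dop β k f) = Dop β (Equiv.swap i j k) (Kswap i j f) := by
  rw [Dop, Dop, ← Kswap_nabla, Kswap, map_mul, rename_X, Kswap]

theorem Dop_add (β : F) (i : Fin N) (f g : MvPolynomial (Fin N) F) :
    Dop β i (f + g) = Dop β i f + Dop β i g := by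
  rw [Dop, nabla_add, mul_add, Dop, Dop]

theorem Dop_smul_sum {ι : Type*} (β : F) (i : Fin N) (c : F) (s : Finset ι)
    (f : ι → MvPolynomial (Fin N) F) :
    Dop β i (c • ∑ k ∈ s, f k) = c • ∑ k ∈ s, Dop β i (f k) := by
  simp only [Dop, nabla_smul, nabla_sum, mul_smul_comm, mul_sum]

theorem Dop_Dop_sub (β : F) {i j : Fin N} (hij : i ≠ j) (f : MvPolynomial (Fin N) F) :
    Dop β i (Dop β j f) - Dop β j (Dop β i f)
      = β • (Dop β j (Kswap i j f) - Dop β i (Kswap i j f)) := by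
  simp only [Dop]
  rw [nabla_X_mul_of_ne β hij.symm, nabla_X_mul_of_ne β hij, Kswap_comm j i, Kswap_nabla,
    Kswap_nabla, Equiv.swap_apply_left, Equiv.swap_apply_right, nabla_comm β i j]
  simp only [mul_sub, smul_sub, mul_smul_comm]
  ring

theorem Dhat_eq [CharZero F] (β : F) (i : Fin N) (f : MvPolynomial (Fin N) F) :
    Dhat β i f = Dop β i f + β • ∑ k ∈ Iio i, Kswap i k f := by
  have h : univ.filter (fun j => j < i) = Iio i := by ext; simp
  rw [Dhat, h, sum_sub_distrib, sum_const, Fin.card_Iio, smul_sub, mul_smul,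
    Nat.cast_smul_eq_nsmul]
  abel

theorem Kswap_smul_sum_add {ι : Type*} (i j : Fin N) (c : F) (s : Finset ι)
    (g : MvPolynomial (Fin N) F) (f : ι → MvPolynomial (Fin N) F) :
    Kswap i j (g + c • ∑ k ∈ s, f k) = Kswap i j g + c • ∑ k ∈ s, Kswap i j (f k) := by
  simp only [Kswap, map_add, map_smul, map_sum]

/-- The Jucys–Murphy sums of transpositions commute. -/
theorem sum_Kswap_comm {i j : Fin N} (hij : i < j) (f : MvPolynomial (Fin N) F) :
    ∑ k ∈ Iio i, ∑ l ∈ Iio j, Kswap i k (Kswap j l f)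
      = ∑ l ∈ Iio j, ∑ k ∈ Iio i, Kswap j l (Kswap i k f) := by
  rw [sum_comm (s := Iio j)]
  refine sum_congr rfl fun k hk => ?_
  have hki : k < i := mem_Iio.1 hk
  have hmem : ∀ l, l ∈ Iio j ↔ Equiv.swap i k l ∈ Iio j := by
    intro l
    rw [mem_Iio, mem_Iio, Equiv.swap_apply_def]
    split_ifs with h₁ h₂
    · simp [h₁, hij, hki.trans hij]
    · simp [h₂, hij, hki.trans hij]
    · rfl
  refine sum_equiv (Equiv.swap i k) hmem fun l _ => ?_
  rw [Kswap, rename_Kswap, Equiv.swap_apply_of_ne_of_ne hij.ne' (hki.trans hij).ne']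
  rfl

theorem Dhat_comm_of_lt [CharZero F] (β : F) {i j : Fin N} (hij : i < j)
    (f : MvPolynomial (Fin N) F) :
    Dhat β i (Dhat β j f) = Dhat β j (Dhat β i f) := by
  have hi : i ∈ Iio j := mem_Iio.2 hij
  have h₁ : ∑ k ∈ Iio i, Kswap i k (Dop β j f) = ∑ k ∈ Iio i, Dop β j (Kswap i k f) :=
    sum_congr rfl fun k hk => by
      rw [Kswap_Dop, Equiv.swap_apply_of_ne_of_ne hij.ne' ((mem_Iio.1 hk).trans hij).ne']
  have h₂ : ∑ l ∈ (Iio j).erase i, Kswap j l (Dop β i f)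
      = ∑ l ∈ (Iio j).erase i, Dop β i (Kswap j l f) :=
    sum_congr rfl fun l hl => by
      rw [Kswap_Dop, Equiv.swap_apply_of_ne_of_ne hij.ne (ne_of_mem_erase hl).symm]
  have h₃ := Dop_Dop_sub β hij.ne f
  have h₄ := sum_Kswap_comm hij f
  simp only [Dhat_eq, Dop_add, Dop_smul_sum, Kswap_smul_sum_add, sum_add_distrib, ← smul_sum]
  rw [h₁, h₄, ← add_sum_erase _ _ hi, ← add_sum_erase (Iio j) (fun l => Kswap j l (Dop β i f)) hi,
    h₂, Kswap_Dop, Equiv.swap_apply_right, Kswap_comm j i, sub_eq_iff_eq_add.1 h₃]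
  simp only [smul_add, smul_sub]
  abel

end Dunkl

/-- The operators `𝐷̂_i` pairwise commute. -/
theorem statement_3 {F : Type*} [Field F] [CharZero F] {N : ℕ} (β : F) (i j : Fin N)
    (f : MvPolynomial (Fin N) F) :
    Dhat β i (Dhat β j f) = Dhat β j (Dhat β i f) := by
  rcases lt_trichotomy i j with h | rfl | h
  · exact Dhat_comm_of_lt β h f
  · rfl
  · exact (Dhat_comm_of_lt β h f).symm
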